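/- arXiv:math/0510310 — 8 statements merged into one kernel-verified Lean document; each statement's English description precedes it below -/
import Mathlib

section
/- Let A be a finite abelian group and B an abelian group. Let Φ : A × A × A → B be a function that is alternating (Φ(a,b,c) = −Φ(b,a,c) and Φ(a,b,c) = −Φ(a,c,b) for all a,b,c ∈ A), satisfies Φ(−a,b,c) = Φ(a,b,c) for all a,b,c ∈ A, and is invariant under simultaneous translation (Φ(a+x, b+x, c+x) = Φ(a,b,c) for all a,b,c,x ∈ A). Then for all a,b ∈ A one has 2 · Σ_{x ∈ A} Φ(a,b,x) = 0 in B. -/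
/-- Let `A` be a finite abelian group and `B` an abelian group.
If `Φ : A × A × A → B` is alternating, satisfies `Φ(-a,b,c) = Φ(a,b,c)` and is invariant
under simultaneous translation, then `2 • ∑_{x ∈ A} Φ(a,b,x) = 0` for all `a b ∈ A`. -/
theorem stmt_0 {A B : Type*} [AddCommGroup A] [Fintype A] [AddCommGroup B]
    (Φ : A → A → A → B)
    (halt1 : ∀ a b c : A, Φ a b c = -Φ b a c)
    (halt2 : ∀ a b c : A, Φ a b c = -Φ a c b)
    (hneg : ∀ a b c : A, Φ (-a) b c = Φ a b c)
    (hshift : ∀ a b c x : A, Φ (a + x) (b + x) (c + x) = Φ a b c) :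
    ∀ a b : A, 2 • (∑ x : A, Φ a b x) = 0 := by
  have hneg₂ : ∀ a b c : A, Φ a (-b) c = Φ a b c := fun a b c => by
    rw [halt1, hneg, ← halt1]
  have hsum : ∀ a b t : A, ∑ x : A, Φ (a + t) (b + t) x = ∑ x : A, Φ a b x := fun a b t => by
    rw [← Equiv.sum_comp (Equiv.addRight t)]
    exact Finset.sum_congr rfl fun x _ => hshift a b x t
  intro a b
  have hsymm : ∑ x : A, Φ a b x = ∑ x : A, Φ b a x := by
    calc ∑ x : A, Φ a b x = ∑ x : A, Φ 0 (b - a) x := by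
          rw [← hsum a b (-a), add_neg_cancel, sub_eq_add_neg]
      _ = ∑ x : A, Φ 0 (a - b) x := by simp only [← neg_sub b a, hneg₂]
      _ = ∑ x : A, Φ b a x := by
          rw [← hsum b a (-b), add_neg_cancel, sub_eq_add_neg]
  rw [two_nsmul]
  nth_rewrite 1 [hsymm]
  rw [← Finset.sum_add_distrib]
  exact Finset.sum_eq_zero fun x _ => by rw [halt1 b a x, neg_add_cancel]
end

section
/- For every f ∈ F with f ≠ 0 and f ≠ 1 the following holds in the exterior square Λ²_ℤ(kˣ) of the abelian group kˣ (written additively): if v(f) = 0 and the residue f̄ of f satisfies f̄ ≠ 1, then Sp_q(1−f) ∧ Sp_q(f) = (1 − f̄) ∧ f̄; and in all other cases (i.e. if v(f) ≠ 0, or if v(f) = 0 and f̄ = 1) one has 2 · (Sp_q(1−f) ∧ Sp_q(f)) = 0. In other words, the specialization map commutes with the differential δ₂, which sends {f} to (1−f) ∧ f, modulo 2-torsion. -/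
/-- The specialization map attached to a discrete valuation ring with uniformizer `q`:
the specialization of `f ∈ Fˣ` is the residue of the unit `f · q^{-v(f)} = U f` in the
residue field `k = R/(q)`. -/
noncomputable def Sp {R F : Type*} [CommRing R] [Field F] [Algebra R F]
    (q : R) (U : Fˣ → Rˣ) (f : Fˣ) : (R ⧸ Ideal.span {q})ˣ :=
  Units.map (Ideal.Quotient.mk (Ideal.span {q})).toMonoidHom (U f)

/-- The wedge `x ∧ y` of two elements of `kˣ` in the exterior square `Λ²_ℤ(kˣ)` of the
abelian group `kˣ` (realized inside the exterior algebra over `ℤ` of `Additive kˣ`). -/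
noncomputable def wedge {k : Type*} [CommRing k] (x y : kˣ) :
    ExteriorAlgebra ℤ (Additive kˣ) :=
  ExteriorAlgebra.ι ℤ (Additive.ofMul x) * ExteriorAlgebra.ι ℤ (Additive.ofMul y)

/-- If an element `x` of `R` not divisible by the prime `q` has the form `w · q ^ m` in the
fraction field, with `w` a unit, then `x = w`. -/
theorem eq_unit_of_eq_unit_mul_zpow {R F : Type*} [CommRing R] [IsDomain R] [Field F]
    [Algebra R F] [IsFractionRing R F] {q : R} (hq : Prime q) {x : R} (hx : ¬ q ∣ x)
    (w : Rˣ) (m : ℤ) (h : algebraMap R F x = algebraMap R F w * (algebraMap R F q) ^ m) :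
    x = w := by
  have hinj := IsFractionRing.injective R F
  have hq0 : algebraMap R F q ≠ 0 := fun h0 => hq.ne_zero (hinj (by simpa using h0))
  obtain ⟨a, rfl | rfl⟩ := m.eq_nat_or_neg
  · have hR : x = w * q ^ a := hinj (by simpa using h)
    rcases Nat.eq_zero_or_pos a with rfl | ha
    · simpa using hR
    · exact absurd (hR ▸ (dvd_pow_self q ha.ne').mul_left _) hx
  · have hR : x * q ^ a = w := hinj (by
      rw [map_mul, h, map_pow, zpow_neg, zpow_natCast, mul_assoc,
        inv_mul_cancel₀ (pow_ne_zero a hq0), mul_one])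
    rcases Nat.eq_zero_or_pos a with rfl | ha
    · simpa using hR
    · exact absurd (isUnit_of_dvd_unit (hR ▸ (dvd_pow_self q ha.ne').mul_left x) w.isUnit)
        hq.not_isUnit

theorem coe_Sp {R F : Type*} [CommRing R] [Field F] [Algebra R F]
    (q : R) (U : Fˣ → Rˣ) (f : Fˣ) :
    (Sp q U f : R ⧸ Ideal.span {q}) = Ideal.Quotient.mk (Ideal.span {q}) (U f : R) := rfl

@[simp]
theorem wedge_one_left {k : Type*} [CommRing k] (y : kˣ) : wedge 1 y = 0 := by
  simp [wedge]

@[simp]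
theorem wedge_one_right {k : Type*} [CommRing k] (x : kˣ) : wedge x 1 = 0 := by
  simp [wedge]

theorem wedge_mul_left {k : Type*} [CommRing k] (x x' y : kˣ) :
    wedge (x * x') y = wedge x y + wedge x' y := by
  simp [wedge, add_mul]

@[simp]
theorem wedge_self {k : Type*} [CommRing k] (x : kˣ) : wedge x x = 0 :=
  ExteriorAlgebra.ι_sq_zero _

theorem two_nsmul_wedge_neg_self {k : Type*} [CommRing k] (x : kˣ) :
    2 • wedge (-x) x = 0 := by
  rw [two_nsmul, ← wedge_mul_left, neg_mul_neg, wedge_mul_left, wedge_self, add_zero]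

/-- Let `R` be a discrete valuation ring with uniformizer `q`, fraction
field `F`, residue field `k = R/(q)` and normalized valuation `v`.  For `f ∈ F`, `f ≠ 0`,
`f ≠ 1`: if `v f = 0` and the residue `f̄` of `f` satisfies `f̄ ≠ 1`, then
`Sp_q(1-f) ∧ Sp_q(f) = (1 - f̄) ∧ f̄` in `Λ²_ℤ(kˣ)`; in all other cases
`2 · (Sp_q(1-f) ∧ Sp_q(f)) = 0`.  That is, the specialization map commutes with the
differential `δ₂ : {f} ↦ (1-f) ∧ f` modulo 2-torsion. -/
theorem stmt_2 {R F : Type*} [CommRing R] [IsDomain R] [Field F] [Algebra R F]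
    [IsFractionRing R F]
    (q : R) (hq : Prime q)
    (v : Fˣ → ℤ) (U : Fˣ → Rˣ)
    (hdec : ∀ f : Fˣ, (f : F) = algebraMap R F (U f) * (algebraMap R F q) ^ (v f))
    (qF : Fˣ) (hqF : (qF : F) = algebraMap R F q) (hv1 : v qF = 1)
    (f : Fˣ) (hf1 : (f : F) ≠ 1)
    (onemf : Fˣ) (honemf : (onemf : F) = 1 - (f : F)) :
    (v f = 0 → (Sp q U f : R ⧸ Ideal.span {q}) ≠ 1 →
      ∀ u : (R ⧸ Ideal.span {q})ˣ,
        (u : R ⧸ Ideal.span {q}) = 1 - (Sp q U f : R ⧸ Ideal.span {q}) →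
          wedge (Sp q U onemf) (Sp q U f) = wedge u (Sp q U f)) ∧
    ((v f ≠ 0 ∨ (Sp q U f : R ⧸ Ideal.span {q}) = 1) →
      2 • wedge (Sp q U onemf) (Sp q U f) = 0) := by
  have hinj := IsFractionRing.injective R F
  have hq0 : algebraMap R F q ≠ 0 := fun h0 => hq.ne_zero (hinj (by simpa using h0))
  have hmk (x : R) : Ideal.Quotient.mk (Ideal.span {q}) x = 0 ↔ q ∣ x := by
    rw [Ideal.Quotient.eq_zero_iff_mem, Ideal.mem_span_singleton]
  have hmkq : Ideal.Quotient.mk (Ideal.span {q}) q = 0 := (hmk q).2 dvd_rfl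
  have hsum : algebraMap R F (U onemf) * algebraMap R F q ^ v onemf =
      1 - algebraMap R F (U f) * algebraMap R F q ^ v f := by
    rw [← hdec, ← hdec, honemf]
  refine ⟨fun hv hne u hu => ?_, ?_⟩
  · have hx : ¬ q ∣ 1 - (U f : R) := fun hd => hne (by
      rw [← hmk, map_sub, map_one, sub_eq_zero] at hd
      exact hd.symm)
    have key := eq_unit_of_eq_unit_mul_zpow (F := F) hq hx (U onemf) (v onemf)
      (by simp [hsum, hv])
    congr 1
    ext
    rw [coe_Sp, ← key, hu, map_sub, map_one, coe_Sp]
  · intro h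
    by_cases h1 : (Sp q U f : R ⧸ Ideal.span {q}) = 1
    · rw [Units.val_eq_one.1 h1, wedge_one_right, smul_zero]
    have hv := h.resolve_right h1
    obtain ⟨a, ha | ha⟩ := (v f).eq_nat_or_neg
    · have ha0 : a ≠ 0 := by rintro rfl; exact hv (by simpa using ha)
      have hmkx : Ideal.Quotient.mk (Ideal.span {q}) (1 - U f * q ^ a) = 1 := by
        simp [hmkq, ha0]
      have hx : ¬ q ∣ 1 - (U f : R) * q ^ a := fun hd =>
        hq.not_isUnit (isUnit_of_dvd_one
          ((dvd_sub_left ((dvd_pow_self q ha0).mul_left _)).1 hd))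
      have key := eq_unit_of_eq_unit_mul_zpow (F := F) hq hx (U onemf) (v onemf)
        (by simp [hsum, ha])
      have hSp : Sp q U onemf = 1 := by
        ext
        rw [coe_Sp, ← key, hmkx, Units.val_one]
      rw [hSp, wedge_one_left, smul_zero]
    · have ha0 : a ≠ 0 := by rintro rfl; exact hv (by simpa using ha)
      have hx : ¬ q ∣ q ^ a - (U f : R) := fun hd =>
        hq.not_isUnit (isUnit_of_dvd_unit
          ((dvd_sub_right (dvd_pow_self q ha0)).1 hd) (U f).isUnit)
      have key := eq_unit_of_eq_unit_mul_zpow (F := F) hq hx (U onemf) (v onemf + a) (by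
        rw [zpow_add₀ hq0, ← mul_assoc, hsum, ha, zpow_neg, zpow_natCast, sub_mul, mul_assoc,
          inv_mul_cancel₀ (pow_ne_zero a hq0)]
        simp)
      have hSp : Sp q U onemf = -Sp q U f := by
        ext
        rw [coe_Sp, ← key, Units.val_neg, coe_Sp]
        simp [hmkq, ha0]
      rw [hSp, two_nsmul_wedge_neg_self]
end

section
/- Let k be a field, N ≥ 1, and let a, b ∈ k satisfy a^N = b^N = 1, a ≠ 1, b ≠ 1, ab ≠ 1; set c = (ab)^{−1}, u₁ = (ab − b)/(1 − b), u₂ = b/(b − 1), u₃ = ab. Then in Λ²(kˣ_ℚ) one has ⟨1−u₁⟩∧⟨u₁⟩ − ⟨1−u₂⟩∧⟨u₂⟩ − ⟨1−u₃⟩∧⟨u₃⟩ = ⟨1−a⟩∧⟨1−b⟩ + ⟨1−b⟩∧⟨1−c⟩ + ⟨1−c⟩∧⟨1−a⟩. (This is the coproduct formula δ₂ Li^M_{1,1}(a,b) = (1−a)∧(1−b) + (1−b)∧(1−c) + (1−c)∧(1−a) for the motivic double logarithm Li^M_{1,1}(a,b) := {(ab−b)/(1−b)}₂ − {b/(b−1)}₂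 − {ab}₂ at N-th roots of unity.) -/
open scoped TensorProduct

open Classical in
/-- The class `⟨x⟩` of a nonzero field element `x` in the `ℚ`-vector space
`kˣ_ℚ = ℚ ⊗_ℤ kˣ` (with junk value `0` for `x = 0`). -/
noncomputable def cl {k : Type*} [Field k] (x : k) : ℚ ⊗[ℤ] Additive kˣ :=
  if h : x = 0 then 0 else (1 : ℚ) ⊗ₜ[ℤ] Additive.ofMul (Units.mk0 x h)

/-- The wedge `⟨x⟩ ∧ ⟨y⟩` in `Λ²_ℚ(kˣ_ℚ)`, realized inside the exterior algebra over `ℚ`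
of the `ℚ`-vector space `kˣ_ℚ = ℚ ⊗_ℤ kˣ`. -/
noncomputable def wdg {k : Type*} [Field k] (x y : k) :
    ExteriorAlgebra ℚ (ℚ ⊗[ℤ] Additive kˣ) :=
  ExteriorAlgebra.ι ℚ (cl x) * ExteriorAlgebra.ι ℚ (cl y)

theorem cl_mul {k : Type*} [Field k] {x y : k} (hx : x ≠ 0) (hy : y ≠ 0) :
    cl (x * y) = cl x + cl y := by
  rw [cl, cl, cl, dif_neg (mul_ne_zero hx hy), dif_neg hx, dif_neg hy, Units.mk0_mul,
    ofMul_mul, TensorProduct.tmul_add]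

theorem cl_one {k : Type*} [Field k] : cl (1 : k) = 0 := by
  rw [cl, dif_neg one_ne_zero, Units.mk0_one, ofMul_one, TensorProduct.tmul_zero]

theorem cl_inv {k : Type*} [Field k] {x : k} (hx : x ≠ 0) : cl x⁻¹ = -cl x := by
  rw [eq_neg_iff_add_eq_zero, ← cl_mul (inv_ne_zero hx) hx, inv_mul_cancel₀ hx, cl_one]

theorem cl_pow {k : Type*} [Field k] {x : k} (hx : x ≠ 0) (n : ℕ) :
    cl (x ^ n) = (n : ℚ) • cl x := by
  induction n with
  | zero => rw [pow_zero, cl_one, Nat.cast_zero, zero_smul]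
  | succ n ih => rw [pow_succ, cl_mul (pow_ne_zero n hx) hx, ih, Nat.cast_succ, add_smul, one_smul]

/-- Roots of unity are torsion, so their class vanishes rationally. -/
theorem cl_eq_zero_of_pow_eq_one {k : Type*} [Field k] {x : k} {n : ℕ} (hn : n ≠ 0)
    (hx : x ^ n = 1) : cl x = 0 := by
  have hx0 : x ≠ 0 := by
    rintro rfl
    rw [zero_pow hn] at hx
    exact zero_ne_one hx
  have h := cl_pow hx0 n
  rw [hx, cl_one] at h
  exact (smul_eq_zero.mp h.symm).resolve_left (Nat.cast_ne_zero.mpr hn)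

theorem cl_neg {k : Type*} [Field k] {x : k} (hx : x ≠ 0) : cl (-x) = cl x := by
  have h : cl (-1 : k) = 0 := cl_eq_zero_of_pow_eq_one two_ne_zero (by ring)
  rw [← neg_one_mul, cl_mul (neg_ne_zero.mpr one_ne_zero) hx, h, zero_add]

/-- Let `k` be a field, `N ≥ 1`, and `a, b ∈ k` with `a^N = b^N = 1`,
`a ≠ 1`, `b ≠ 1`, `ab ≠ 1`.  Set `c = (ab)⁻¹`, `u₁ = (ab - b)/(1 - b)`, `u₂ = b/(b-1)`,
`u₃ = ab`.  Then, in `Λ²(kˣ_ℚ)`,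
`⟨1-u₁⟩∧⟨u₁⟩ - ⟨1-u₂⟩∧⟨u₂⟩ - ⟨1-u₃⟩∧⟨u₃⟩
   = ⟨1-a⟩∧⟨1-b⟩ + ⟨1-b⟩∧⟨1-c⟩ + ⟨1-c⟩∧⟨1-a⟩`,
the coproduct formula for the motivic double logarithm at roots of unity. -/
theorem stmt_3 {k : Type*} [Field k] (N : ℕ) (hN : 1 ≤ N) (a b : k)
    (haN : a ^ N = 1) (hbN : b ^ N = 1) (ha1 : a ≠ 1) (hb1 : b ≠ 1) (hab1 : a * b ≠ 1) :
    wdg (1 - (a * b - b) / (1 - b)) ((a * b - b) / (1 - b))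
      - wdg (1 - b / (b - 1)) (b / (b - 1))
      - wdg (1 - a * b) (a * b)
    = wdg (1 - a) (1 - b) + wdg (1 - b) (1 - (a * b)⁻¹)
        + wdg (1 - (a * b)⁻¹) (1 - a) := by
  have hN0 : N ≠ 0 := Nat.one_le_iff_ne_zero.mp hN
  have habN : (a * b) ^ N = 1 := by rw [mul_pow, haN, hbN, one_mul]
  have hb0 : b ≠ 0 := by
    rintro rfl
    exact zero_ne_one ((zero_pow hN0).symm.trans hbN)
  have ha0 : a ≠ 0 := by
    rintro rfl
    exact zero_ne_one ((zero_pow hN0).symm.trans haN)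
  have hab0 : a * b ≠ 0 := mul_ne_zero ha0 hb0
  have hA : 1 - a ≠ 0 := sub_ne_zero.mpr ha1.symm
  have hB : 1 - b ≠ 0 := sub_ne_zero.mpr hb1.symm
  have hB' : b - 1 ≠ 0 := sub_ne_zero.mpr hb1
  have hC : 1 - a * b ≠ 0 := sub_ne_zero.mpr hab1.symm
  have clb : cl b = 0 := cl_eq_zero_of_pow_eq_one hN0 hbN
  have clab : cl (a * b) = 0 := cl_eq_zero_of_pow_eq_one hN0 habN
  have cl_one_sub_u₁ : cl (1 - (a * b - b) / (1 - b)) = cl (1 - a * b) - cl (1 - b) := by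
    rw [show 1 - (a * b - b) / (1 - b) = (1 - a * b) * (1 - b)⁻¹ by field_simp; ring,
      cl_mul hC (inv_ne_zero hB), cl_inv hB, ← sub_eq_add_neg]
  have cl_u₁ : cl ((a * b - b) / (1 - b)) = cl (1 - a) - cl (1 - b) := by
    rw [show (a * b - b) / (1 - b) = -(b * ((1 - a) * (1 - b)⁻¹)) by field_simp; ring,
      cl_neg (mul_ne_zero hb0 (mul_ne_zero hA (inv_ne_zero hB))),
      cl_mul hb0 (mul_ne_zero hA (inv_ne_zero hB)), cl_mul hA (inv_ne_zero hB), cl_inv hB, clb,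
      zero_add, ← sub_eq_add_neg]
  have cl_one_sub_u₂ : cl (1 - b / (b - 1)) = -cl (1 - b) := by
    rw [show 1 - b / (b - 1) = (1 - b)⁻¹ by
      rw [one_sub_div hB', sub_sub_cancel_left, ← neg_sub 1 b, neg_div_neg_eq, one_div], cl_inv hB]
  have cl_u₂ : cl (b / (b - 1)) = -cl (1 - b) := by
    rw [← neg_sub 1 b, div_neg, cl_neg (div_ne_zero hb0 hB), div_eq_mul_inv,
      cl_mul hb0 (inv_ne_zero hB), cl_inv hB, clb, zero_add]
  have cl_one_sub_c : cl (1 - (a * b)⁻¹) = cl (1 - a * b) := by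
    rw [show 1 - (a * b)⁻¹ = -((1 - a * b) * (a * b)⁻¹) by field_simp; ring,
      cl_neg (mul_ne_zero hC (inv_ne_zero hab0)), cl_mul hC (inv_ne_zero hab0), cl_inv hab0, clab,
      neg_zero, add_zero]
  have anticomm (x y : ℚ ⊗[ℤ] Additive kˣ) : ExteriorAlgebra.ι ℚ x * ExteriorAlgebra.ι ℚ y =
      -(ExteriorAlgebra.ι ℚ y * ExteriorAlgebra.ι ℚ x) :=
    eq_neg_of_add_eq_zero_left (ExteriorAlgebra.ι_add_mul_swap x y)
  simp only [wdg, cl_one_sub_u₁, cl_u₁, cl_one_sub_u₂, cl_u₂, clab, cl_one_sub_c, map_sub, map_neg,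
    map_zero, mul_zero, sub_zero]
  rw [anticomm (cl (1 - a)) (cl (1 - b)), anticomm (cl (1 - b)) (cl (1 - a * b))]
  noncomm_ring
end

section
/- Let R be a principal ideal domain and P a nonzero maximal ideal of R. The map sending g ∈ GL₂(R) to its bottom row (0,1)·g reduced modulo P induces a well-defined bijection from the left coset space Γ₁(P)\GL₂(R) onto (R/P)² ∖ {(0,0)}. -/
open scoped MatrixGroups

/-- Membership in `Γ₁(I) ⊆ GL₂(R)`: the bottom row `(0,1)·g` of `g` is congruent to
`(0,1)` modulo the ideal `I` (entrywise). -/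
def memGamma1 {R : Type*} [CommRing R] (I : Ideal R) (g : GL (Fin 2) R) : Prop :=
  (↑g : Matrix (Fin 2) (Fin 2) R) 1 0 ∈ I ∧ (↑g : Matrix (Fin 2) (Fin 2) R) 1 1 - 1 ∈ I

/-- The bottom row `(0,1)·g` of `g ∈ GL₂(R)` reduced modulo the ideal `I`, as an element
of `(R/I)²`. -/
def botRow {R : Type*} [CommRing R] (I : Ideal R) (g : GL (Fin 2) R) : Fin 2 → R ⧸ I :=
  fun j => Ideal.Quotient.mk I ((↑g : Matrix (Fin 2) (Fin 2) R) 1 j)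

theorem botRow_eq_iff {R : Type*} [CommRing R] (I : Ideal R) (g h : GL (Fin 2) R) :
    botRow I g = botRow I h ↔ ∀ j, g.val 1 j - h.val 1 j ∈ I := by
  simp only [funext_iff, botRow, Ideal.Quotient.eq]

theorem botRow_ne_zero {R : Type*} [CommRing R] {I : Ideal R} (hI : I ≠ ⊤)
    (g : GL (Fin 2) R) : botRow I g ≠ 0 := by
  intro h0
  have hmem (j : Fin 2) : g.val 1 j ∈ I := Ideal.Quotient.eq_zero_iff_mem.mp (congrFun h0 j)
  have hone : g.val 1 0 * g⁻¹.val 0 1 + g.val 1 1 * g⁻¹.val 1 1 = 1 := by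
    simpa [Matrix.mul_apply] using congrFun₂ g.mul_inv 1 1
  refine hI ((Ideal.eq_top_iff_one I).mpr ?_)
  rw [← hone]
  exact add_mem (I.mul_mem_right _ (hmem 0)) (I.mul_mem_right _ (hmem 1))

theorem botRow_eq_iff_memGamma1 {R : Type*} [CommRing R] (I : Ideal R) (g h : GL (Fin 2) R) :
    botRow I g = botRow I h ↔ memGamma1 I (g * h⁻¹) := by
  have hinv (j : Fin 2) : h.val 1 0 * h⁻¹.val 0 j + h.val 1 1 * h⁻¹.val 1 j =
      (1 : Matrix (Fin 2) (Fin 2) R) 1 j := by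
    simpa only [Matrix.mul_apply, Fin.sum_univ_two] using congrFun₂ h.mul_inv 1 j
  have hgh (j : Fin 2) : (g * h⁻¹).val 1 j =
      g.val 1 0 * h⁻¹.val 0 j + g.val 1 1 * h⁻¹.val 1 j := by
    simp only [Units.val_mul, Matrix.mul_apply, Fin.sum_univ_two]
  have hg (j : Fin 2) : g.val 1 j =
      (g * h⁻¹).val 1 0 * h.val 0 j + (g * h⁻¹).val 1 1 * h.val 1 j := by
    conv_lhs => rw [← inv_mul_cancel_right g h]
    simp only [Units.val_mul (g * h⁻¹), Matrix.mul_apply, Fin.sum_univ_two]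
  rw [botRow_eq_iff]
  constructor
  · intro hj
    have key (j : Fin 2) : (g * h⁻¹).val 1 j - (1 : Matrix (Fin 2) (Fin 2) R) 1 j ∈ I := by
      have : (g * h⁻¹).val 1 j - (1 : Matrix (Fin 2) (Fin 2) R) 1 j =
          (g.val 1 0 - h.val 1 0) * h⁻¹.val 0 j + (g.val 1 1 - h.val 1 1) * h⁻¹.val 1 j := by
        rw [hgh, ← hinv]; ring
      rw [this]
      exact add_mem (I.mul_mem_right _ (hj 0)) (I.mul_mem_right _ (hj 1))
    exact ⟨by simpa using key 0, by simpa using key 1⟩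
  · rintro ⟨h0, h1⟩ j
    have : g.val 1 j - h.val 1 j =
        (g * h⁻¹).val 1 0 * h.val 0 j + ((g * h⁻¹).val 1 1 - 1) * h.val 1 j := by
      rw [hg j]; ring
    rw [this]
    exact add_mem (I.mul_mem_right _ h0) (I.mul_mem_right _ h1)

theorem exists_botRow_eq {R : Type*} [CommRing R] {P : Ideal R} (hP : P.IsMaximal)
    {w : Fin 2 → R ⧸ P} (hw : w ≠ 0) : ∃ g : GL (Fin 2) R, botRow P g = w := by
  let _ : Field (R ⧸ P) := Ideal.Quotient.field P
  by_cases h0 : w 0 = 0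
  · have h1 : w 1 ≠ 0 := fun h1 => hw (funext (Fin.forall_fin_two.mpr ⟨h0, h1⟩))
    obtain ⟨y, hy⟩ := Ideal.Quotient.mk_surjective (w 1 - 1)
    obtain ⟨z, hz⟩ := Ideal.Quotient.mk_surjective (-(w 1)⁻¹)
    refine ⟨Matrix.GeneralLinearGroup.mk'' !![1 + y * z, y; 1 + z * (1 + y), 1 + y] ?_, ?_⟩
    · rw [show Matrix.det !![1 + y * z, y; 1 + z * (1 + y), 1 + y] = 1 by
        rw [Matrix.det_fin_two_of]; ring]
      exact isUnit_one
    · refine funext (Fin.forall_fin_two.mpr ⟨?_, ?_⟩)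
      · change Ideal.Quotient.mk P (1 + z * (1 + y)) = w 0
        rw [map_add, map_mul, map_add, map_one, hy, hz, h0, add_sub_cancel, neg_mul,
          inv_mul_cancel₀ h1, add_neg_cancel]
      · change Ideal.Quotient.mk P (1 + y) = w 1
        rw [map_add, map_one, hy, add_sub_cancel]
  · obtain ⟨x, hx⟩ := Ideal.Quotient.mk_surjective (w 0)
    obtain ⟨y, hy⟩ := Ideal.Quotient.mk_surjective ((w 0)⁻¹ * (w 1 - 1))
    refine ⟨Matrix.GeneralLinearGroup.mk'' !![1, y; x, 1 + x * y] ?_, ?_⟩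
    · rw [show Matrix.det !![1, y; x, 1 + x * y] = 1 by rw [Matrix.det_fin_two_of]; ring]
      exact isUnit_one
    · refine funext (Fin.forall_fin_two.mpr ⟨hx, ?_⟩)
      change Ideal.Quotient.mk P (1 + x * y) = w 1
      rw [map_add, map_mul, map_one, hx, hy, mul_inv_cancel_left₀ h0, add_sub_cancel]

/-- Let `R` be a PID and `P` a nonzero maximal ideal.  The map sending
`g ∈ GL₂(R)` to its bottom row mod `P` induces a well-defined bijection
`Γ₁(P)\GL₂(R) ≃ (R/P)² ∖ {(0,0)}`: the bottom row mod `P` is never zero, every nonzero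
vector of `(R/P)²` arises, and two matrices have the same bottom row mod `P` iff they lie
in the same left coset of `Γ₁(P)`. -/
theorem stmt_6 {R : Type*} [CommRing R] [IsDomain R] [IsPrincipalIdealRing R]
    (P : Ideal R) (hP0 : P ≠ ⊥) (hP : P.IsMaximal) :
    (∀ g : GL (Fin 2) R, botRow P g ≠ 0) ∧
    (∀ w : Fin 2 → R ⧸ P, w ≠ 0 → ∃ g : GL (Fin 2) R, botRow P g = w) ∧
    (∀ g h : GL (Fin 2) R, botRow P g = botRow P h ↔ memGamma1 P (g * h⁻¹)) := by
  exact ⟨botRow_ne_zero hP.ne_top, fun _ hw => exists_botRow_eq hP hw,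
    botRow_eq_iff_memGamma1 P⟩
end

section
/- Let R be a principal ideal domain and I a nonzero ideal of R. The map sending g ∈ GL₂(R) to its bottom row (0,1)·g reduced modulo I induces a well-defined bijection from the left coset space Γ₁(I)\GL₂(R) onto the set of unimodular rows {(α, β) ∈ (R/I)² : α·(R/I) + β·(R/I) = R/I}. -/
open scoped MatrixGroups

theorem botRow_mul_right_congr {R : Type*} [CommRing R] (I : Ideal R) {g h : GL (Fin 2) R}
    (hgh : botRow I g = botRow I h) (k : GL (Fin 2) R) : botRow I (g * k) = botRow I (h * k) := by
  funext j
  have h0 := congrFun hgh 0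
  have h1 := congrFun hgh 1
  simp only [botRow] at h0 h1
  simp [botRow, Matrix.mul_apply, Fin.sum_univ_two, h0, h1]

theorem memGamma1_iff_botRow_eq_one {R : Type*} [CommRing R] (I : Ideal R) (g : GL (Fin 2) R) :
    memGamma1 I g ↔ botRow I g = botRow I 1 := by
  simp [memGamma1, botRow, funext_iff, Fin.forall_fin_two, Ideal.Quotient.eq]

theorem isCoprime_botRow {R : Type*} [CommRing R] (I : Ideal R) (g : GL (Fin 2) R) :
    IsCoprime (botRow I g 0) (botRow I g 1) := by
  have hg : IsCoprime (g 1 0) (g 1 1) := by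
    have hmul : (g * g⁻¹) 1 1 = 1 := by simp
    rw [Matrix.GeneralLinearGroup.coe_mul, Matrix.mul_apply, Fin.sum_univ_two] at hmul
    exact ⟨g⁻¹ 0 1, g⁻¹ 1 1, by linear_combination hmul⟩
  exact hg.map (Ideal.Quotient.mk I)

/-- If `a`, `n` and `b ≠ 0` have no common prime factor, then some element of the progression
`a + t * n` is coprime to `b`. -/
theorem exists_isCoprime_add_mul {R : Type*} [CommRing R] [IsDomain R] [IsPrincipalIdealRing R]
    {a n b : R} (hb : b ≠ 0) (habn : ∀ p, Prime p → p ∣ a → p ∣ n → ¬ p ∣ b) :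
    ∃ t, IsCoprime (a + t * n) b := by
  induction b using UniqueFactorizationMonoid.induction_on_prime with
  | h₁ => exact absurd rfl hb
  | h₂ b hu => exact ⟨0, isCoprime_one_right.of_isCoprime_of_dvd_right (isUnit_iff_dvd_one.mp hu)⟩
  | h₃ b p hb0 hp ih =>
    obtain ⟨t, ht⟩ := ih hb0 fun q hq ha hn hqb => habn q hq ha hn (hqb.mul_left p)
    by_cases hpt : p ∣ a + t * n
    · have hpn : ¬ p ∣ n := fun hn =>
        habn p hp ((dvd_add_left (hn.mul_left t)).mp hpt) hn (dvd_mul_right p b)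
      have hpb : ¬ p ∣ b := fun h => hp.not_isUnit (ht.isUnit_of_dvd' hpt h)
      have heq : a + (t + b) * n = a + t * n + b * n := by ring
      refine ⟨t + b, IsCoprime.mul_right ?_ ?_⟩
      · refine ((hp.irreducible.coprime_iff_not_dvd).mpr ?_).symm
        rw [heq, dvd_add_right hpt]
        exact hp.not_dvd_mul hpb hpn
      · rw [heq]
        exact ht.add_mul_left_left n
    · exact ⟨t, ((hp.irreducible.coprime_iff_not_dvd).mpr hpt).symm.mul_right ht⟩

/-- Coprime residues modulo a nonzero ideal of a PID lift to coprime elements. -/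
theorem exists_isCoprime_lift {R : Type*} [CommRing R] [IsDomain R] [IsPrincipalIdealRing R]
    {I : Ideal R} (hI : I ≠ ⊥) {α β : R ⧸ I} (h : IsCoprime α β) :
    ∃ a b : R, IsCoprime a b ∧ Ideal.Quotient.mk I a = α ∧ Ideal.Quotient.mk I b = β := by
  obtain ⟨n, rfl⟩ := IsPrincipalIdealRing.principal I
  have hn0 : n ≠ 0 := by
    rintro rfl
    simp at hI
  obtain ⟨a, rfl⟩ := Ideal.Quotient.mk_surjective α
  obtain ⟨b, hb0, rfl⟩ : ∃ b ≠ 0, Ideal.Quotient.mk (Ideal.span {n}) b = β := by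
    obtain ⟨b, rfl⟩ := Ideal.Quotient.mk_surjective β
    by_cases hb : b = 0
    · exact ⟨n, hn0, by simp [hb]⟩
    · exact ⟨b, hb, rfl⟩
  obtain ⟨x, y, hxy⟩ := h
  obtain ⟨x, rfl⟩ := Ideal.Quotient.mk_surjective x
  obtain ⟨y, rfl⟩ := Ideal.Quotient.mk_surjective y
  have hdvd : n ∣ x * a + y * b - 1 := by
    rw [← Ideal.mem_span_singleton, ← Ideal.Quotient.eq]
    simpa using hxy
  obtain ⟨t, ht⟩ := exists_isCoprime_add_mul (a := a) (n := n) hb0 fun p hp ha hn hb =>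
    hp.not_isUnit <| isUnit_of_dvd_one <|
      (dvd_sub_right ((ha.mul_left x).add (hb.mul_left y))).mp (hn.trans hdvd)
  refine ⟨_, b, ht, ?_, rfl⟩
  rw [Ideal.Quotient.eq, Ideal.mem_span_singleton]
  exact ⟨t, by ring⟩

/-- Let `R` be a PID and `I` a nonzero ideal.  The map sending
`g ∈ GL₂(R)` to its bottom row mod `I` induces a well-defined bijection
`Γ₁(I)\GL₂(R) ≃ {unimodular rows (α,β) ∈ (R/I)²}`: the bottom row mod `I` is always
unimodular (`α·(R/I) + β·(R/I) = R/I`, i.e. `IsCoprime α β`), every unimodular row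
arises, and two matrices have the same bottom row mod `I` iff they lie in the same left
coset of `Γ₁(I)`. -/
theorem stmt_7 {R : Type*} [CommRing R] [IsDomain R] [IsPrincipalIdealRing R]
    (I : Ideal R) (hI0 : I ≠ ⊥) :
    (∀ g : GL (Fin 2) R, IsCoprime (botRow I g 0) (botRow I g 1)) ∧
    (∀ α β : R ⧸ I, IsCoprime α β → ∃ g : GL (Fin 2) R, botRow I g = ![α, β]) ∧
    (∀ g h : GL (Fin 2) R, botRow I g = botRow I h ↔ memGamma1 I (g * h⁻¹)) := by
  refine ⟨isCoprime_botRow I, fun α β h => ?_, botRow_eq_iff_memGamma1 I⟩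
  obtain ⟨a, b, hab, rfl, rfl⟩ := exists_isCoprime_lift hI0 h
  obtain ⟨g, h0, h1⟩ := hab.exists_SL2_row 1
  exact ⟨g, by simp [botRow, funext_iff, Fin.forall_fin_two, h0, h1]⟩
end

section
/- Let R be a principal ideal domain, P a nonzero maximal ideal of R, and B(R) the subgroup of upper-triangular matrices in GL₂(R). Let U denote the image of the unit group Rˣ in (R/P)ˣ under reduction. Then the double coset space Γ₁(P)\GL₂(R)/B(R) is in bijection with the disjoint union of two copies of the quotient group (R/P)ˣ/U: the double coset of g, whose bottom row modulo P is (α, β), corresponds to the class [α] in the first copy if α ≠ 0, and to the class [β] in the second copy if α = 0. -/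
open scoped MatrixGroups

/-- Membership in the Borel subgroup `B(R) ⊆ GL₂(R)` of upper-triangular matrices:
the lower-left entry vanishes. -/
def memB {R : Type*} [CommRing R] (b : GL (Fin 2) R) : Prop :=
  (↑b : Matrix (Fin 2) (Fin 2) R) 1 0 = 0

open Classical in
/-- The unit attached to an invertible element of a monoid (junk value `1` otherwise).
In the residue field `R/P` of a maximal ideal, every nonzero element is invertible. -/
noncomputable def toUnit {M : Type*} [Monoid M] (x : M) : Mˣ :=
  if h : IsUnit x then h.unit else 1

open Classical in
/-- The classifying invariant of a double coset in `Γ₁(P)\GL₂(R)/B(R)`: if the bottom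
row of `g` mod `P` is `(α, β)`, it is the class `[α] ∈ (R/P)ˣ/U` in the first copy when
`α ≠ 0`, and the class `[β]` in the second copy when `α = 0`; here `U` is the image of
`Rˣ` in `(R/P)ˣ`. -/
noncomputable def cls {R : Type*} [CommRing R] (P : Ideal R)
    (g : GL (Fin 2) R) :
    ((R ⧸ P)ˣ ⧸ (Units.map (Ideal.Quotient.mk P).toMonoidHom).range) ⊕
      ((R ⧸ P)ˣ ⧸ (Units.map (Ideal.Quotient.mk P).toMonoidHom).range) :=
  if Ideal.Quotient.mk P ((↑g : Matrix (Fin 2) (Fin 2) R) 1 0) = 0 then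
    Sum.inr (QuotientGroup.mk
      (toUnit (Ideal.Quotient.mk P ((↑g : Matrix (Fin 2) (Fin 2) R) 1 1))))
  else
    Sum.inl (QuotientGroup.mk
      (toUnit (Ideal.Quotient.mk P ((↑g : Matrix (Fin 2) (Fin 2) R) 1 0))))

theorem toUnit_eq_of_val {M : Type*} [Monoid M] (u : Mˣ) : toUnit (u : M) = u := by
  unfold toUnit
  rw [dif_pos u.isUnit]
  exact Units.ext rfl

theorem val_toUnit {F : Type*} [Field F] {x : F} (hx : x ≠ 0) : (toUnit x : F) = x := by
  unfold toUnit
  rw [dif_pos hx.isUnit]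
  rfl

section

variable {R : Type*} [CommRing R]

/-- Classes of residues modulo the image of `Rˣ` agree iff the residues differ by the reduction
of a unit. -/
theorem mk_toUnit_eq_iff {P : Ideal R} (hP : P.IsMaximal) {x y : R ⧸ P}
    (hx : x ≠ 0) (hy : y ≠ 0) :
    (QuotientGroup.mk (toUnit x) :
        (R ⧸ P)ˣ ⧸ (Units.map (Ideal.Quotient.mk P).toMonoidHom).range) =
      QuotientGroup.mk (toUnit y) ↔ ∃ u : Rˣ, y = x * Ideal.Quotient.mk P u := by
  let := Ideal.Quotient.field P
  have hx' := val_toUnit hx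
  have hy' := val_toUnit hy
  rw [QuotientGroup.eq]
  constructor
  · rintro ⟨u, hu⟩
    refine ⟨u, ?_⟩
    have h := congrArg Units.val (eq_inv_mul_iff_mul_eq.mp hu)
    rw [Units.val_mul, hx', hy'] at h
    exact h.symm
  · rintro ⟨u, hu⟩
    refine ⟨u, eq_inv_mul_iff_mul_eq.mpr (Units.ext ?_)⟩
    rw [Units.val_mul, hx', hy']
    exact hu.symm

theorem cls_of_mem {P : Ideal R} {g : GL (Fin 2) R} (h : Ideal.Quotient.mk P (g.1 1 0) = 0) :
    cls P g = Sum.inr (QuotientGroup.mk (toUnit (Ideal.Quotient.mk P (g.1 1 1)))) :=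
  if_pos h

theorem cls_of_notMem {P : Ideal R} {g : GL (Fin 2) R}
    (h : Ideal.Quotient.mk P (g.1 1 0) ≠ 0) :
    cls P g = Sum.inl (QuotientGroup.mk (toUnit (Ideal.Quotient.mk P (g.1 1 0)))) :=
  if_neg h

theorem mk_apply_one_one_ne_zero {P : Ideal R} (hP : P.IsMaximal) {g : GL (Fin 2) R}
    (h : Ideal.Quotient.mk P (g.1 1 0) = 0) : Ideal.Quotient.mk P (g.1 1 1) ≠ 0 := by
  intro h1
  rw [Ideal.Quotient.eq_zero_iff_mem] at h h1
  have hd : g.1.det ∈ P := by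
    rw [Matrix.det_fin_two]
    exact P.sub_mem (P.mul_mem_left _ h1) (P.mul_mem_left _ h)
  exact hP.ne_top (P.eq_top_of_isUnit_mem hd ((Matrix.isUnit_iff_isUnit_det _).mp g.isUnit))

theorem memGamma1_mul_inv {P : Ideal R} {g h : GL (Fin 2) R}
    (hgh : ∀ j, Ideal.Quotient.mk P (g.1 1 j) = Ideal.Quotient.mk P (h.1 1 j)) :
    memGamma1 P (g * h⁻¹) := by
  have key : ∀ j, Ideal.Quotient.mk P ((g * h⁻¹).1 1 j) =
      Ideal.Quotient.mk P ((1 : GL (Fin 2) R).1 1 j) := by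
    intro j
    rw [← mul_inv_cancel h]
    simp only [Units.val_mul, Matrix.mul_apply, map_sum, map_mul, hgh]
  constructor
  · rw [← Ideal.Quotient.eq_zero_iff_mem]
    simpa using key 0
  · rw [← Ideal.Quotient.mk_eq_mk_iff_sub_mem]
    simpa using key 1

theorem mk_mul_apply_one {P : Ideal R} {γ : GL (Fin 2) R} (hγ : memGamma1 P γ)
    (h : GL (Fin 2) R) (j : Fin 2) :
    Ideal.Quotient.mk P ((γ * h).1 1 j) = Ideal.Quotient.mk P (h.1 1 j) := by
  have h0 := Ideal.Quotient.eq_zero_iff_mem.mpr hγ.1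
  have h1 := (Ideal.Quotient.mk_eq_mk_iff_sub_mem _ _).mpr hγ.2
  simp [Matrix.mul_apply, Fin.sum_univ_two, h0, h1]

theorem mul_apply_one_zero_of_memB {b : GL (Fin 2) R} (hb : memB b) (g : GL (Fin 2) R) :
    (g * b).1 1 0 = g.1 1 0 * b.1 0 0 := by
  have hb' : b.1 1 0 = 0 := hb
  simp [Matrix.mul_apply, Fin.sum_univ_two, hb']

theorem isUnit_diag_of_memB {b : GL (Fin 2) R} (hb : memB b) :
    IsUnit (b.1 0 0) ∧ IsUnit (b.1 1 1) := by
  have hb' : b.1 1 0 = 0 := hb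
  have h := (Matrix.isUnit_iff_isUnit_det _).mp b.isUnit
  rw [Matrix.det_fin_two, hb', mul_zero, sub_zero] at h
  exact IsUnit.mul_iff.mp h

theorem exists_memB (u v : Rˣ) (y : R) :
    ∃ b : GL (Fin 2) R, b.1 = !![(u : R), y; 0, (v : R)] := by
  refine ⟨Matrix.GeneralLinearGroup.mk'' !![(u : R), y; 0, (v : R)] ?_, rfl⟩
  simp [Matrix.det_fin_two_of]

theorem cls_mul_mul {P : Ideal R} (hP : P.IsMaximal) {γ b : GL (Fin 2) R}
    (hγ : memGamma1 P γ) (hb : memB b) (g : GL (Fin 2) R) :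
    cls P g = cls P (γ * g * b) := by
  let := Ideal.Quotient.field P
  obtain ⟨⟨u, hu⟩, ⟨v, hv⟩⟩ := isUnit_diag_of_memB hb
  have h0 : Ideal.Quotient.mk P ((γ * g * b).1 1 0) =
      Ideal.Quotient.mk P (g.1 1 0) * Ideal.Quotient.mk P u := by
    rw [mul_assoc, mk_mul_apply_one hγ, mul_apply_one_zero_of_memB hb, map_mul, hu]
  by_cases hα : Ideal.Quotient.mk P (g.1 1 0) = 0
  · have hα' : Ideal.Quotient.mk P ((γ * g * b).1 1 0) = 0 := by rw [h0, hα, zero_mul]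
    rw [cls_of_mem hα, cls_of_mem hα', Sum.inr.injEq,
      mk_toUnit_eq_iff hP (mk_apply_one_one_ne_zero hP hα) (mk_apply_one_one_ne_zero hP hα')]
    refine ⟨v, ?_⟩
    rw [mul_assoc, mk_mul_apply_one hγ]
    simp [Matrix.mul_apply, Fin.sum_univ_two, hα, hv]
  · have hα' : Ideal.Quotient.mk P ((γ * g * b).1 1 0) ≠ 0 := by
      rw [h0]
      exact mul_ne_zero hα (u.isUnit.map (Ideal.Quotient.mk P)).ne_zero
    rw [cls_of_notMem hα, cls_of_notMem hα', Sum.inl.injEq, mk_toUnit_eq_iff hP hα hα']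
    exact ⟨u, h0⟩

theorem exists_memB_of_cls_eq {P : Ideal R} (hP : P.IsMaximal) {g g' : GL (Fin 2) R}
    (h : cls P g = cls P g') :
    ∃ b : GL (Fin 2) R, memB b ∧
      ∀ j, Ideal.Quotient.mk P (g'.1 1 j) = Ideal.Quotient.mk P ((g * b).1 1 j) := by
  let := Ideal.Quotient.field P
  by_cases hα : Ideal.Quotient.mk P (g.1 1 0) = 0 <;>
    by_cases hα' : Ideal.Quotient.mk P (g'.1 1 0) = 0
  · rw [cls_of_mem hα, cls_of_mem hα', Sum.inr.injEq,
      mk_toUnit_eq_iff hP (mk_apply_one_one_ne_zero hP hα)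
        (mk_apply_one_one_ne_zero hP hα')] at h
    obtain ⟨u, hu⟩ := h
    obtain ⟨b, hb⟩ := exists_memB 1 u 0
    refine ⟨b, by simp [memB, hb], fun j => ?_⟩
    fin_cases j <;> simp [Matrix.mul_apply, Fin.sum_univ_two, hb, hα, hα', hu]
  · rw [cls_of_mem hα, cls_of_notMem hα'] at h
    cases h
  · rw [cls_of_notMem hα, cls_of_mem hα'] at h
    cases h
  · rw [cls_of_notMem hα, cls_of_notMem hα', Sum.inl.injEq, mk_toUnit_eq_iff hP hα hα'] at h
    obtain ⟨u, hu⟩ := h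
    obtain ⟨y, hy⟩ := Ideal.Quotient.mk_surjective ((Ideal.Quotient.mk P (g.1 1 0))⁻¹ *
      (Ideal.Quotient.mk P (g'.1 1 1) - Ideal.Quotient.mk P (g.1 1 1)))
    obtain ⟨b, hb⟩ := exists_memB u 1 y
    refine ⟨b, by simp [memB, hb], fun j => ?_⟩
    fin_cases j
    · simp [Matrix.mul_apply, Fin.sum_univ_two, hb, hu]
    · simp [Matrix.mul_apply, Fin.sum_univ_two, hb, hy, mul_inv_cancel_left₀ hα]

theorem cls_surjective {P : Ideal R} (hP : P.IsMaximal) : Function.Surjective (cls P) := by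
  let := Ideal.Quotient.field P
  rintro (x | x) <;> obtain ⟨x, rfl⟩ := QuotientGroup.mk_surjective x <;>
    obtain ⟨a, ha⟩ := Ideal.Quotient.mk_surjective (x : R ⧸ P)
  · let g : GL (Fin 2) R := Matrix.GeneralLinearGroup.mk'' !![a - 1, 1; a, 1]
      (by simp [Matrix.det_fin_two_of])
    have hg : Ideal.Quotient.mk P (g.1 1 0) = x := ha
    refine ⟨g, ?_⟩
    rw [cls_of_notMem (hg ▸ x.ne_zero), hg, toUnit_eq_of_val]
  · obtain ⟨r, hr⟩ := Ideal.Quotient.mk_surjective ((x⁻¹ : (R ⧸ P)ˣ) : R ⧸ P)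
    let g : GL (Fin 2) R := Matrix.GeneralLinearGroup.mk'' !![r, -1; 1 - r * a, a]
      (by simp [Matrix.det_fin_two_of])
    have hg : Ideal.Quotient.mk P (g.1 1 1) = x := ha
    have hg0 : Ideal.Quotient.mk P (g.1 1 0) = 0 := by
      change Ideal.Quotient.mk P (1 - r * a) = 0
      rw [map_sub, map_mul, hr, ha, map_one, Units.inv_mul, sub_self]
    refine ⟨g, ?_⟩
    rw [cls_of_mem hg0, hg, toUnit_eq_of_val]

end

/-- Let `R` be a PID, `P` a nonzero maximal ideal, `B(R)` the
upper-triangular subgroup of `GL₂(R)`, and `U` the image of `Rˣ` in `(R/P)ˣ`.  Then the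
invariant `cls` identifies the double coset space `Γ₁(P)\GL₂(R)/B(R)` with the disjoint
union of two copies of `(R/P)ˣ/U`: two matrices have the same invariant iff they lie in
the same double coset, and every value is attained. -/
theorem stmt_9 {R : Type*} [CommRing R] [IsDomain R] [IsPrincipalIdealRing R]
    (P : Ideal R) (hP0 : P ≠ ⊥) (hP : P.IsMaximal) :
    (∀ g g' : GL (Fin 2) R,
      cls P g = cls P g' ↔
        ∃ γ b : GL (Fin 2) R, memGamma1 P γ ∧ memB b ∧ g' = γ * g * b) ∧
    Function.Surjective (cls P) := by
  refine ⟨fun g g' => ⟨fun h => ?_, ?_⟩, cls_surjective hP⟩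
  · obtain ⟨b, hb, hrow⟩ := exists_memB_of_cls_eq hP h
    exact ⟨g' * (g * b)⁻¹, b, memGamma1_mul_inv hrow, hb, by group⟩
  · rintro ⟨γ, b, hγ, hb, rfl⟩
    exact cls_mul_mul hP hγ hb g
end

section
/- Let α₁, α₂ ∈ ℝ with 0 ≤ α₁ < 1, and assume that α₂ ∉ ℤ in case α₁ = 0. For t > 0 set q = e^{−2πt} ∈ (0,1) and z = e^{−2πα₁t}·e^{2πiα₂} ∈ ℂ. Then: (a) for every t > 0 the infinite product Π_{n=1}^{∞} (1 − qⁿz)(1 − qⁿz^{−1}) converges; (b) as t → +∞, the normalized theta value q^{−B₂(α₁)/2}·θ_q(z) = −e^{πiα₂(α₁−1)}·(1−z)·Π_{n=1}^{∞}(1 − qⁿz)(1 − qⁿz^{−1}) tends to −e^{πiα₂(α₁−1)}·(1 − e^{2πiα₂}) if α₁ = 0, and tends to −e^{πiα₂(α₁−1)} if 0 < α₁ < 1. In particular, up to a root of unity, the specialization of the modular unit at the cusp equals the cyclotomic element 1 − e^{2πiα₂} when α₁ = 0, and is a root of unity when 0 < α₁ < 1. -/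
open Filter

/-- `q = e^{-2πt}`. -/
noncomputable def qq (t : ℝ) : ℝ := Real.exp (-(2 * Real.pi * t))

/-- `z = e^{-2πα₁t}·e^{2πiα₂}`. -/
noncomputable def zz (α₁ α₂ t : ℝ) : ℂ :=
  (Real.exp (-(2 * Real.pi * α₁ * t)) : ℂ) *
    Complex.exp (((2 * Real.pi * α₂ : ℝ) : ℂ) * Complex.I)

/-- The `n`-th factor `(1 - q^{n+1} z)(1 - q^{n+1} z⁻¹)` (so `n` runs over `0, 1, 2, …`,
i.e. the factors are indexed by `n + 1 = 1, 2, 3, …`). -/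
noncomputable def thetaTerm (α₁ α₂ t : ℝ) (n : ℕ) : ℂ :=
  (1 - ((qq t : ℂ)) ^ (n + 1) * zz α₁ α₂ t) *
    (1 - ((qq t : ℂ)) ^ (n + 1) * (zz α₁ α₂ t)⁻¹)

/-- The normalized theta value
`q^{-B₂(α₁)/2}·θ_q(z) = -e^{πiα₂(α₁-1)}·(1-z)·Π_{n=1}^∞ (1-qⁿz)(1-qⁿz⁻¹)`. -/
noncomputable def normTheta (α₁ α₂ t : ℝ) : ℂ :=
  -Complex.exp (((Real.pi * α₂ * (α₁ - 1) : ℝ) : ℂ) * Complex.I) * (1 - zz α₁ α₂ t) *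
    ∏' n : ℕ, thetaTerm α₁ α₂ t n

lemma norm_zz (α₁ α₂ t : ℝ) : ‖zz α₁ α₂ t‖ = Real.exp (-(2 * Real.pi * α₁ * t)) := by
  rw [zz, norm_mul, Complex.norm_exp_ofReal_mul_I, mul_one, Complex.norm_real,
    Real.norm_of_nonneg (Real.exp_pos _).le]

lemma norm_qq (t : ℝ) : ‖(qq t : ℂ)‖ = qq t := by
  rw [Complex.norm_real, qq, Real.norm_of_nonneg (Real.exp_pos _).le]

/-- The ratio `|q z⁻¹| = e^{-2π(1-α₁)t}`, which dominates both halves of `thetaTerm`. -/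
noncomputable def thetaRatio (α₁ t : ℝ) : ℝ := Real.exp (-(2 * Real.pi * (1 - α₁) * t))

lemma thetaRatio_pos (α₁ t : ℝ) : 0 < thetaRatio α₁ t := Real.exp_pos _

lemma thetaRatio_lt_one {α₁ t : ℝ} (h1 : α₁ < 1) (ht : 0 < t) : thetaRatio α₁ t < 1 := by
  have h1' : 0 < 1 - α₁ := sub_pos.2 h1
  rw [thetaRatio, Real.exp_lt_one_iff, neg_lt_zero]
  positivity

lemma tendsto_exp_neg_two_pi_mul {c : ℝ} (hc : 0 < c) :
    Tendsto (fun t : ℝ => Real.exp (-(2 * Real.pi * c * t))) atTop (nhds 0) :=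
  Real.tendsto_exp_neg_atTop_nhds_zero.comp
    (tendsto_id.const_mul_atTop (by positivity : 0 < 2 * Real.pi * c))

lemma norm_thetaTerm_sub_one_le {α₁ : ℝ} (α₂ : ℝ) {t : ℝ} (h0 : 0 ≤ α₁) (h1 : α₁ < 1)
    (ht : 0 < t) (n : ℕ) :
    ‖thetaTerm α₁ α₂ t n - 1‖ ≤ 3 * thetaRatio α₁ t ^ (n + 1) := by
  set r := thetaRatio α₁ t with hr
  have hr0 : 0 < r := thetaRatio_pos _ _
  have hr1 : r < 1 := thetaRatio_lt_one h1 ht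
  have hq0 : 0 < qq t := Real.exp_pos _
  have hπ := Real.pi_pos
  have hqr : qq t ≤ r := by
    rw [hr, thetaRatio, qq, Real.exp_le_exp]
    have : 0 ≤ 2 * Real.pi * α₁ * t := by positivity
    linarith
  have hz1 : ‖zz α₁ α₂ t‖ ≤ 1 := by
    rw [norm_zz, Real.exp_le_one_iff, neg_nonpos]
    positivity
  have hqz : qq t * ‖(zz α₁ α₂ t)⁻¹‖ = r := by
    rw [norm_inv, norm_zz, ← Real.exp_neg, qq, ← Real.exp_add, hr, thetaRatio]
    congr 1
    ring
  set a := (qq t : ℂ) ^ (n + 1) * zz α₁ α₂ t with ha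
  set b := (qq t : ℂ) ^ (n + 1) * (zz α₁ α₂ t)⁻¹ with hb
  have hna : ‖a‖ ≤ r ^ (n + 1) := by
    rw [ha, norm_mul, norm_pow, norm_qq]
    calc qq t ^ (n + 1) * ‖zz α₁ α₂ t‖ ≤ qq t ^ (n + 1) * 1 := by gcongr
      _ = qq t ^ (n + 1) := mul_one _
      _ ≤ r ^ (n + 1) := by gcongr
  have hnb : ‖b‖ ≤ r ^ (n + 1) := by
    rw [hb, norm_mul, norm_pow, norm_qq, pow_succ, mul_assoc, hqz, pow_succ]
    gcongr
  have hrn : r ^ (n + 1) ≤ 1 := pow_le_one₀ hr0.le hr1.le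
  calc ‖thetaTerm α₁ α₂ t n - 1‖ = ‖a * b - a - b‖ := by
        rw [thetaTerm, ← ha, ← hb]
        congr 1
        ring
    _ ≤ ‖a‖ * ‖b‖ + ‖a‖ + ‖b‖ := by
        rw [← norm_mul]
        exact (norm_sub_le _ _).trans (by gcongr; exact norm_sub_le _ _)
    _ ≤ 1 * r ^ (n + 1) + r ^ (n + 1) + r ^ (n + 1) := by
        gcongr
        exact hna.trans hrn
    _ = 3 * r ^ (n + 1) := by ring

lemma summable_three_mul_pow_succ {r : ℝ} (hr0 : 0 ≤ r) (hr1 : r < 1) :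
    Summable fun n : ℕ => 3 * r ^ (n + 1) :=
  ((summable_nat_add_iff 1).2 (summable_geometric_of_lt_one hr0 hr1)).mul_left 3

lemma multipliable_thetaTerm {α₁ : ℝ} (α₂ : ℝ) {t : ℝ} (h0 : 0 ≤ α₁) (h1 : α₁ < 1)
    (ht : 0 < t) : Multipliable (thetaTerm α₁ α₂ t) := by
  have hs : Summable fun n => ‖thetaTerm α₁ α₂ t n - 1‖ :=
    (summable_three_mul_pow_succ (thetaRatio_pos _ _).le (thetaRatio_lt_one h1 ht)).of_nonneg_of_le
      (fun _ => norm_nonneg _) (norm_thetaTerm_sub_one_le α₂ h0 h1 ht)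
  simpa using multipliable_one_add_of_summable hs

lemma tendsto_tprod_thetaTerm {α₁ : ℝ} (α₂ : ℝ) (h0 : 0 ≤ α₁) (h1 : α₁ < 1) :
    Tendsto (fun t => ∏' n, thetaTerm α₁ α₂ t n) atTop (nhds 1) := by
  have hr : Tendsto (thetaRatio α₁) atTop (nhds 0) := tendsto_exp_neg_two_pi_mul (sub_pos.2 h1)
  have key := tendsto_tprod_one_add_of_dominated_convergence (𝓕 := atTop) (g := fun _ => (0 : ℂ))
    (f := fun t n => thetaTerm α₁ α₂ t n - 1)
    (summable_three_mul_pow_succ (r := 1 / 2) (by norm_num) (by norm_num))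
    (fun n => ?_) ?_
  · simpa using key
  · refine squeeze_zero_norm' ?_ (by simpa using (hr.pow (n + 1)).const_mul 3)
    filter_upwards [eventually_gt_atTop 0] with t ht
    exact norm_thetaTerm_sub_one_le α₂ h0 h1 ht n
  · filter_upwards [eventually_gt_atTop 0,
      hr.eventually_le_const (by norm_num : (0 : ℝ) < 1 / 2)] with t ht htr n
    refine (norm_thetaTerm_sub_one_le α₂ h0 h1 ht n).trans ?_
    have := (thetaRatio_pos α₁ t).le
    gcongr

lemma tendsto_normTheta {α₁ α₂ : ℝ} (h0 : 0 ≤ α₁) (h1 : α₁ < 1) {w : ℂ}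
    (hw : Tendsto (zz α₁ α₂) atTop (nhds w)) :
    Tendsto (normTheta α₁ α₂) atTop
      (nhds (-Complex.exp (((Real.pi * α₂ * (α₁ - 1) : ℝ) : ℂ) * Complex.I) * (1 - w))) := by
  rw [← mul_one (_ * (1 - w))]
  exact ((hw.const_sub 1).const_mul _).mul (tendsto_tprod_thetaTerm α₂ h0 h1)

/-- Let `0 ≤ α₁ < 1`, with `α₂ ∉ ℤ` in case `α₁ = 0`.  For `t > 0` set
`q = e^{-2πt}` and `z = e^{-2πα₁t}e^{2πiα₂}`.  Then (a) for every `t > 0` the infinite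
product `Π_{n≥1} (1-qⁿz)(1-qⁿz⁻¹)` converges; and (b) as `t → +∞` the normalized theta
value `q^{-B₂(α₁)/2}·θ_q(z)` tends to `-e^{πiα₂(α₁-1)}·(1 - e^{2πiα₂})` if `α₁ = 0`, and
tends to `-e^{πiα₂(α₁-1)}` if `0 < α₁ < 1`. -/
theorem stmt_10 (α₁ α₂ : ℝ) (h0 : 0 ≤ α₁) (h1 : α₁ < 1)
    (hint : α₁ = 0 → ¬∃ m : ℤ, α₂ = m) :
    (∀ t : ℝ, 0 < t → Multipliable (thetaTerm α₁ α₂ t)) ∧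
    (α₁ = 0 → Tendsto (fun t => normTheta α₁ α₂ t) atTop
      (nhds (-Complex.exp (((Real.pi * α₂ * (α₁ - 1) : ℝ) : ℂ) * Complex.I) *
        (1 - Complex.exp (((2 * Real.pi * α₂ : ℝ) : ℂ) * Complex.I))))) ∧
    (0 < α₁ → Tendsto (fun t => normTheta α₁ α₂ t) atTop
      (nhds (-Complex.exp (((Real.pi * α₂ * (α₁ - 1) : ℝ) : ℂ) * Complex.I)))) := by
  refine ⟨fun t ht => multipliable_thetaTerm α₂ h0 h1 ht, fun h => ?_, fun h => ?_⟩
  · refine tendsto_normTheta h0 h1 (tendsto_const_nhds.congr fun t => ?_)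
    simp [zz, h]
  · have hz : Tendsto (zz α₁ α₂) atTop (nhds 0) :=
      tendsto_zero_iff_norm_tendsto_zero.2 <| by
        simpa only [norm_zz] using tendsto_exp_neg_two_pi_mul h
    simpa only [sub_zero, mul_one] using tendsto_normTheta h0 h1 hz
end

section
/- Let S be a finite nonempty set. Let V be the ℚ-vector space with basis (e_a)_{a ∈ S}, let V̂ = V ⊕ ℚ·e₀, let s : V → ℚ be the linear form with s(e_a) = 1 for all a ∈ S, let W = ker(s) ⊆ V, and let Σ : V ⊕ V → ℚ be the map (u, v) ↦ s(u) + s(v). Let δ' : Λ²_ℚ(V̂) → V ⊕ V be the unique linear map with δ'(e_a ∧ e_b) = (0, e_a − e_b) for a, b ∈ S and δ'(e₀ ∧ e_b) = (−e_b, e_b) for b ∈ S. Then the image of δ' equals the kernel of Σ, and the kernel of δ' equals the image of the natural map Λ²_ℚ(W) → Λ²_ℚ(V̂). -/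
/-- The wedge `x ∧ y` of two vectors, as an element of the second exterior power
`⋀[ℚ]^2 M` (a submodule of the exterior algebra). -/
noncomputable def wedge2 {M : Type*} [AddCommGroup M] [Module ℚ M] (x y : M) :
    ⋀[ℚ]^2 M :=
  ⟨ExteriorAlgebra.ιMulti ℚ 2 ![x, y],
    ExteriorAlgebra.ιMulti_range ℚ 2 (Set.mem_range_self _)⟩

theorem coe_wedge2 {M : Type*} [AddCommGroup M] [Module ℚ M] (x y : M) :
    (wedge2 x y : ExteriorAlgebra ℚ M) = ExteriorAlgebra.ι ℚ x * ExteriorAlgebra.ι ℚ y := by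
  simp [wedge2, ExteriorAlgebra.ιMulti_apply]

/-- `wedge2` as a bilinear map. -/
noncomputable def wedge2Bilin (M : Type*) [AddCommGroup M] [Module ℚ M] :
    M →ₗ[ℚ] M →ₗ[ℚ] ⋀[ℚ]^2 M :=
  LinearMap.mk₂ ℚ wedge2
    (fun _ _ _ => Subtype.ext (by simp [coe_wedge2, add_mul]))
    (fun _ _ _ => Subtype.ext (by simp [coe_wedge2]))
    (fun _ _ _ => Subtype.ext (by simp [coe_wedge2, mul_add]))
    (fun _ _ _ => Subtype.ext (by simp [coe_wedge2]))

theorem wedge2Bilin_apply {M : Type*} [AddCommGroup M] [Module ℚ M] (x y : M) :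
    wedge2Bilin M x y = wedge2 x y := rfl

theorem wedge2_self {M : Type*} [AddCommGroup M] [Module ℚ M] (x : M) :
    wedge2 x x = 0 :=
  Subtype.ext (by simp [coe_wedge2])

theorem wedge2_swap {M : Type*} [AddCommGroup M] [Module ℚ M] (x y : M) :
    wedge2 y x = -wedge2 x y :=
  Subtype.ext <| by
    rw [Submodule.coe_neg, coe_wedge2, coe_wedge2]
    exact eq_neg_of_add_eq_zero_left (ExteriorAlgebra.ι_add_mul_swap y x)

/-- Linear maps out of the second exterior power agree if they agree on all `x ∧ y`. -/
theorem linearMap_ext_wedge2 {M N : Type*} [AddCommGroup M] [Module ℚ M]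
    [AddCommGroup N] [Module ℚ N] {f g : ⋀[ℚ]^2 M →ₗ[ℚ] N}
    (h : ∀ x y, f (wedge2 x y) = g (wedge2 x y)) : f = g := by
  refine exteriorPower.linearMap_ext (AlternatingMap.ext fun m => ?_)
  have hm : exteriorPower.ιMulti ℚ 2 m = wedge2 (m 0) (m 1) :=
    Subtype.ext (by simp [coe_wedge2, ExteriorAlgebra.ιMulti_apply, Matrix.vecTail])
  simpa [hm] using h (m 0) (m 1)

theorem map_wedge2 {M N : Type*} [AddCommGroup M] [Module ℚ M]
    [AddCommGroup N] [Module ℚ N] (f : M →ₗ[ℚ] N) (x y : M) :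
    exteriorPower.map 2 f (wedge2 x y) = wedge2 (f x) (f y) := by
  refine (exteriorPower.map_apply_ιMulti f ![x, y]).trans (Subtype.ext ?_)
  simp [coe_wedge2, ExteriorAlgebra.ιMulti_apply, Matrix.vecTail]

/-- Let `S` be a finite nonempty set, `V = ℚ^S` with basis `(e_a)`,
`V̂ = V ⊕ ℚ·e₀`, `s : V → ℚ` the linear form with `s(e_a) = 1`, `W = ker s`, and
`Σ : V ⊕ V → ℚ`, `(u,v) ↦ s(u) + s(v)`.  Let `δ' : Λ²(V̂) → V ⊕ V` be the (unique)
linear map with `δ'(e_a ∧ e_b) = (0, e_a - e_b)` and `δ'(e₀ ∧ e_b) = (-e_b, e_b)`.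
Then `im δ' = ker Σ`, and `ker δ'` is the image of the natural map
`Λ²(W) → Λ²(V̂)` induced by the inclusion `W ⊆ V ⊆ V̂`. -/
theorem stmt_11 {S : Type*} [Fintype S] [Nonempty S] [DecidableEq S]
    (s : (S → ℚ) →ₗ[ℚ] ℚ) (hs : ∀ a : S, s (Pi.single a 1) = 1)
    (Sig : ((S → ℚ) × (S → ℚ)) →ₗ[ℚ] ℚ)
    (hSig : ∀ uv : (S → ℚ) × (S → ℚ), Sig uv = s uv.1 + s uv.2)
    (δ' : (⋀[ℚ]^2 ((S → ℚ) × ℚ)) →ₗ[ℚ] ((S → ℚ) × (S → ℚ)))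
    (hab : ∀ a b : S, δ' (wedge2 ((Pi.single a 1 : S → ℚ), (0 : ℚ))
        ((Pi.single b 1 : S → ℚ), (0 : ℚ)))
        = (0, Pi.single a 1 - Pi.single b 1))
    (h0b : ∀ b : S, δ' (wedge2 ((0 : S → ℚ), (1 : ℚ))
        ((Pi.single b 1 : S → ℚ), (0 : ℚ)))
        = (-(Pi.single b 1), Pi.single b 1))
    (j : (⋀[ℚ]^2 (LinearMap.ker s)) →ₗ[ℚ] (⋀[ℚ]^2 ((S → ℚ) × ℚ)))
    (hj : ∀ w : ⋀[ℚ]^2 (LinearMap.ker s),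
      (j w : ExteriorAlgebra ℚ ((S → ℚ) × ℚ)) =
        ExteriorAlgebra.map ((LinearMap.inl ℚ (S → ℚ) ℚ).comp (LinearMap.ker s).subtype)
          (w : ExteriorAlgebra ℚ (LinearMap.ker s))) :
    LinearMap.range δ' = LinearMap.ker Sig ∧ LinearMap.ker δ' = LinearMap.range j := by
  have hδ : ∀ x y : (S → ℚ) × ℚ, δ' (wedge2 x y) =
      (y.2 • x.1 - x.2 • y.1, s y.1 • x.1 - s x.1 • y.1 + x.2 • y.1 - y.2 • x.1) := by
    let D : (S → ℚ) × ℚ →ₗ[ℚ] (S → ℚ) × ℚ →ₗ[ℚ] (S → ℚ) × (S → ℚ) :=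
      LinearMap.mk₂ ℚ
        (fun x y => (y.2 • x.1 - x.2 • y.1,
          s y.1 • x.1 - s x.1 • y.1 + x.2 • y.1 - y.2 • x.1))
        (fun _ _ _ => by ext <;> simp <;> ring)
        (fun _ _ _ => by ext <;> simp <;> ring)
        (fun _ _ _ => by ext <;> simp <;> ring)
        (fun _ _ _ => by ext <;> simp <;> ring)
    have key : (wedge2Bilin _).compr₂ δ' = D := by
      refine LinearMap.prod_ext (LinearMap.pi_ext' fun a => LinearMap.ext_ring ?_)
        (LinearMap.ext_ring ?_) <;>
      refine LinearMap.prod_ext (LinearMap.pi_ext' fun b => LinearMap.ext_ring ?_)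
        (LinearMap.ext_ring ?_)
      · simp [wedge2Bilin_apply, D, hab, hs]
      · simp [wedge2Bilin_apply, D, wedge2_swap ((0 : S → ℚ), (1 : ℚ)), h0b]
      · simp [wedge2Bilin_apply, D, h0b]
      · simp [wedge2Bilin_apply, D, wedge2_self]
        rfl
    exact fun x y => LinearMap.congr_fun₂ key x y
  have hjw : ∀ x y : LinearMap.ker s,
      j (wedge2 x y) = wedge2 ((x : S → ℚ), (0 : ℚ)) ((y : S → ℚ), (0 : ℚ)) := fun x y =>
    Subtype.ext (by simp [hj, coe_wedge2])
  obtain ⟨a⟩ := ‹Nonempty S›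
  set e : S → ℚ := Pi.single a 1
  have he : s e = 1 := hs a
  -- `(v, c) ↦ v - s(v) e`, a retraction of the inclusion of `ker s`
  let R : (S → ℚ) × ℚ →ₗ[ℚ] LinearMap.ker s :=
    LinearMap.codRestrict _
      ((LinearMap.id - s.smulRight e) ∘ₗ LinearMap.fst ℚ (S → ℚ) ℚ) (by simp [he])
  -- `(x, y) ↦ - e₀ ∧ x + (x + y) ∧ e`, a section of `δ'` over `ker Sig`
  let L : (S → ℚ) × (S → ℚ) →ₗ[ℚ] ⋀[ℚ]^2 ((S → ℚ) × ℚ) :=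
    -(wedge2Bilin _ ((0 : S → ℚ), (1 : ℚ)) ∘ₗ LinearMap.inl ℚ (S → ℚ) ℚ ∘ₗ
        LinearMap.fst ℚ (S → ℚ) (S → ℚ)) +
      (wedge2Bilin _).flip (e, (0 : ℚ)) ∘ₗ LinearMap.inl ℚ (S → ℚ) ℚ ∘ₗ
        (LinearMap.fst ℚ (S → ℚ) (S → ℚ) + LinearMap.snd ℚ (S → ℚ) (S → ℚ))
  have hdecomp : j ∘ₗ exteriorPower.map 2 R + L ∘ₗ δ' = LinearMap.id := by
    refine linearMap_ext_wedge2 fun x y => ?_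
    have hL : L (δ' (wedge2 x y)) =
        -wedge2 ((0 : S → ℚ), (1 : ℚ)) (y.2 • x.1 - x.2 • y.1, (0 : ℚ)) +
          wedge2 (s y.1 • x.1 - s x.1 • y.1, (0 : ℚ)) (e, (0 : ℚ)) := by
      rw [hδ]
      simp only [L, LinearMap.add_apply, LinearMap.neg_apply, LinearMap.comp_apply,
        LinearMap.fst_apply, LinearMap.snd_apply, LinearMap.inl_apply, LinearMap.flip_apply,
        wedge2Bilin_apply]
      congr 3
      abel
    have hR : ∀ z, (R z : S → ℚ) = z.1 - s z.1 • e := fun z => rfl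
    rw [LinearMap.add_apply, LinearMap.comp_apply, LinearMap.comp_apply, map_wedge2, hjw, hL,
      hR, hR, LinearMap.id_apply]
    obtain ⟨u, c⟩ := x
    obtain ⟨v, d⟩ := y
    have hi : ∀ w : S → ℚ, (w, (0 : ℚ)) = LinearMap.inl ℚ (S → ℚ) ℚ w := fun _ => rfl
    have hp : ∀ (w : S → ℚ) (t : ℚ), (w, t) = LinearMap.inl ℚ (S → ℚ) ℚ w +
        t • ((0 : S → ℚ), (1 : ℚ)) := fun w t => by simp
    dsimp only
    rw [hp u c, hp v d]
    simp only [← wedge2Bilin_apply, hi, map_add, map_sub, map_smul, LinearMap.add_apply,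
      LinearMap.sub_apply, LinearMap.smul_apply]
    simp only [wedge2Bilin_apply, wedge2_self,
      wedge2_swap (LinearMap.inl ℚ (S → ℚ) ℚ v) (LinearMap.inl ℚ (S → ℚ) ℚ e),
      wedge2_swap ((0 : S → ℚ), (1 : ℚ)) (LinearMap.inl ℚ (S → ℚ) ℚ u)]
    module
  constructor
  · apply le_antisymm
    · rw [LinearMap.range_le_ker_iff]
      refine linearMap_ext_wedge2 fun x y => ?_
      simp [hδ, hSig]
      ring
    · rintro ⟨x, y⟩ hxy
      rw [LinearMap.mem_ker, hSig] at hxy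
      have hxy' : s x + s y = 0 := hxy
      refine ⟨L (x, y), ?_⟩
      simp [L, wedge2Bilin_apply, hδ, he, hxy']
  · apply le_antisymm
    · intro x hx
      refine ⟨exteriorPower.map 2 R x, ?_⟩
      simpa [LinearMap.mem_ker.mp hx] using LinearMap.congr_fun hdecomp x
    · rw [LinearMap.range_le_ker_iff]
      refine linearMap_ext_wedge2 fun x y => ?_
      simp [hjw, hδ]
end
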